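/- arXiv:1412.8670 — 6 statements merged into one kernel-verified Lean document; each statement's English description precedes it below -/
import Mathlib

section
/- Let R ∈ (0,1], ε > 0 and 0 ≤ α ≤ h⁻¹(R), and set β = (1−α)·h( (h⁻¹(R)−α)/(1−α) ). There exists N such that for every n ≥ N, every codebook C ⊆ {0,1}^n with |C| ≥ 2^{n(R+ε)} admits a subset S ⊆ [n] with |S| ≥ n·α that is ⌈2^{nβ}⌉-shattered by C. -/
/-- The binary entropy function (base 2). -/
noncomputable def binH (p : ℝ) : ℝ :=
  -(p * Real.logb 2 p) - (1 - p) * Real.logb 2 (1 - p)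

/-- The inverse of the binary entropy function, restricted to `[0, 1/2]`. -/
noncomputable def binHInv (y : ℝ) : ℝ :=
  sInf {p : ℝ | 0 ≤ p ∧ p ≤ 1 / 2 ∧ binH p = y}

/-- `S ⊆ [n]` is `k`-shattered by `C ⊆ {0,1}^n`: every vector in `{0,1}^S` has at least
`k` preimages in `C` under the restriction map `c ↦ c(S)`. -/
def KShatters {n : ℕ} (k : ℕ) (C : Finset (Fin n → Fin 2)) (S : Finset (Fin n)) : Prop :=
  ∀ g : ↥S → Fin 2, k ≤ (C.filter (fun c => ∀ i : ↥S, c i.1 = g i)).card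


/-- set version of k-shattering -/
def SetSh {α : Type*} [DecidableEq α] (k : ℕ) (A : Finset (Finset α)) (S : Finset α) : Prop :=
  ∀ U, U ⊆ S → k ≤ (A.filter (fun T => T ∩ S = U)).card

def shiftMap {α : Type*} [DecidableEq α] (a : α) (A : Finset (Finset α)) (T : Finset α) :
    Finset α := if T.erase a ∈ A then T else T.erase a

lemma shift_inj {α : Type*} [DecidableEq α] (a : α) (A : Finset (Finset α)) :
    Set.InjOn (shiftMap a A) (A : Set (Finset α)) := by
  intro T hT T' hT' h
  simp only [shiftMap, Finset.mem_coe] at *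
  split_ifs at h with h1 h2 h2
  · exact h
  · exact absurd (h ▸ hT) h2
  · exact absurd (h ▸ hT') h1
  · have ha : a ∈ T := by
      by_contra hc
      rw [Finset.erase_eq_of_notMem hc] at h1; exact h1 hT
    have ha' : a ∈ T' := by
      by_contra hc
      rw [Finset.erase_eq_of_notMem hc] at h2; exact h2 hT'
    rw [← Finset.insert_erase ha, ← Finset.insert_erase ha', h]

lemma shift_sh {α : Type*} [DecidableEq α] (a : α) (A : Finset (Finset α)) (k : ℕ)
    (S : Finset α) (h : SetSh k (A.image (shiftMap a A)) S) : SetSh k A S := by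
  intro U hU
  by_cases ha : a ∈ S
  · have key : ∀ T, T ∈ A.image (shiftMap a A) → a ∈ T → T ∈ A ∧ T.erase a ∈ A := by
      intro T hT haT
      obtain ⟨T0, h0, rfl⟩ := Finset.mem_image.1 hT
      unfold shiftMap at *
      split_ifs at * with h1
      · exact ⟨h0, h1⟩
      · simp at haT
    have h2 := h (insert a U) (Finset.insert_subset ha hU)
    by_cases haU : a ∈ U
    · rw [Finset.insert_eq_of_mem haU] at h2
      refine h2.trans (Finset.card_le_card ?_)
      intro T hT
      rw [Finset.mem_filter] at hT ⊢
      refine ⟨(key T hT.1 ?_).1, hT.2⟩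
      rw [← hT.2] at haU
      exact (Finset.mem_inter.1 haU).1
    · refine h2.trans (Finset.card_le_card_of_injOn (fun T => T.erase a) ?_ ?_)
      · intro T hT
        simp only [Finset.coe_filter, Set.mem_ofPred_eq] at hT ⊢
        have haT : a ∈ T := by
          have : a ∈ T ∩ S := by rw [hT.2]; simp
          exact (Finset.mem_inter.1 this).1
        refine ⟨(key T hT.1 haT).2, ?_⟩
        rw [Finset.erase_inter, hT.2, Finset.erase_insert haU]
      · intro T hT T' hT' hh
        simp only [Finset.coe_filter, Set.mem_ofPred_eq] at hT hT' hh
        have haT : a ∈ T := by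
          have : a ∈ T ∩ S := by rw [hT.2]; simp
          exact (Finset.mem_inter.1 this).1
        have haT' : a ∈ T' := by
          have : a ∈ T' ∩ S := by rw [hT'.2]; simp
          exact (Finset.mem_inter.1 this).1
        rw [← Finset.insert_erase haT, ← Finset.insert_erase haT', hh]
  · refine (h U hU).trans ?_
    have : (A.image (shiftMap a A)).filter (fun T => T ∩ S = U) ⊆
        (A.filter (fun T => T ∩ S = U)).image (shiftMap a A) := by
      intro T hT
      rw [Finset.mem_filter] at hT
      obtain ⟨T0, h0, rfl⟩ := Finset.mem_image.1 hT.1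
      refine Finset.mem_image_of_mem _ (Finset.mem_filter.2 ⟨h0, ?_⟩)
      rw [← hT.2]
      unfold shiftMap
      split_ifs
      · rfl
      · ext x
        simp only [Finset.mem_inter, Finset.mem_erase]
        constructor
        · rintro ⟨h1, h2⟩
          exact ⟨⟨fun h => ha (h ▸ h2), h1⟩, h2⟩
        · rintro ⟨⟨_, h1⟩, h2⟩
          exact ⟨h1, h2⟩
    exact (Finset.card_le_card this).trans Finset.card_image_le

lemma exists_down {α : Type*} [DecidableEq α] (m : ℕ) : ∀ (A : Finset (Finset α)),
    (∑ T ∈ A, T.card = m) →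
    ∃ D : Finset (Finset α), D.card = A.card ∧ (∀ T ∈ D, ∀ a, T.erase a ∈ D) ∧
      ∀ k S, SetSh k D S → SetSh k A S := by
  induction m using Nat.strong_induction_on with
  | _ m ih =>
    intro A hA
    by_cases hd : ∀ T ∈ A, ∀ a, T.erase a ∈ A
    · exact ⟨A, rfl, hd, fun _ _ h => h⟩
    · push Not at hd
      obtain ⟨T, hT, a, ha⟩ := hd
      have haT : a ∈ T := by
        by_contra hc
        rw [Finset.erase_eq_of_notMem hc] at ha; exact ha hT
      have hlt : ∑ T ∈ A.image (shiftMap a A), T.card < m := by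
        rw [Finset.sum_image (shift_inj a A), ← hA]
        refine Finset.sum_lt_sum ?_ ⟨T, hT, ?_⟩
        · intro i _
          unfold shiftMap
          split_ifs
          · exact le_rfl
          · exact Finset.card_le_card (Finset.erase_subset _ _)
        · unfold shiftMap
          rw [if_neg ha]
          exact Finset.card_erase_lt_of_mem haT
      obtain ⟨D, h1, h2, h3⟩ := ih _ hlt _ rfl
      refine ⟨D, ?_, h2, fun k S h => shift_sh a A k S (h3 k S h)⟩
      rw [h1, Finset.card_image_of_injOn (shift_inj a A)]

lemma down_sh {α : Type*} [DecidableEq α] (D : Finset (Finset α))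
    (hD : ∀ T ∈ D, ∀ a, T.erase a ∈ D) (S : Finset α) :
    SetSh (D.filter (fun T => S ⊆ T)).card D S := by
  have hsd : ∀ V : Finset α, ∀ T ∈ D, T \ V ∈ D := by
    intro V
    induction V using Finset.induction_on with
    | empty => simp
    | insert a V _ ih =>
      intro T hT
      have := hD _ (ih T hT) a
      rwa [Finset.sdiff_insert]
  intro U hU
  refine Finset.card_le_card_of_injOn (fun T => T \ (S \ U)) ?_ ?_
  · intro T hT
    simp only [Finset.coe_filter, Set.mem_ofPred_eq] at hT ⊢
    refine ⟨hsd _ _ hT.1, ?_⟩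
    ext x
    have h1 := @hT.2 x
    have h2 := @hU x
    simp only [Finset.mem_inter, Finset.mem_sdiff]
    tauto
  · intro T hT T' hT' hh
    simp only [Finset.coe_filter, Set.mem_ofPred_eq] at hT hT' hh
    ext x
    have h1 := @hT.2 x
    have h2 := @hT'.2 x
    have h3 := Finset.ext_iff.1 hh x
    simp only [Finset.mem_sdiff] at h3
    tauto

lemma setSh_mono {α : Type*} [DecidableEq α] {k l : ℕ} (h : k ≤ l) (A : Finset (Finset α))
    (S : Finset α) (H : SetSh l A S) : SetSh k A S := fun U hU => h.trans (H U hU)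

/-- translation -/
lemma kshatters_of_setSh {n : ℕ} (k : ℕ) (C : Finset (Fin n → Fin 2)) (S : Finset (Fin n))
    (h : SetSh k (C.image (fun c => Finset.univ.filter (fun i => c i = 1))) S) :
    KShatters k C S := by
  intro g
  refine (h (S.attach.filter (fun i => g i = 1) |>.map (Function.Embedding.subtype _)) ?_).trans ?_
  · intro x hx
    simp at hx
    exact hx.1
  · refine (Finset.card_le_card ?_).trans
      (Finset.card_image_le (f := fun c : Fin n → Fin 2 => Finset.univ.filter (fun i => c i = 1)))
    intro T hT
    rw [Finset.mem_filter] at hT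
    obtain ⟨c, hc, rfl⟩ := Finset.mem_image.1 hT.1
    refine Finset.mem_image_of_mem _ (Finset.mem_filter.2 ⟨hc, ?_⟩)
    rintro ⟨i, hi⟩
    have := Finset.ext_iff.1 hT.2 i
    simp [hi] at this
    show c i = g ⟨i, hi⟩
    omega

lemma card_toSets {n : ℕ} (C : Finset (Fin n → Fin 2)) :
    (C.image (fun c => Finset.univ.filter (fun i => c i = 1))).card = C.card := by
  refine Finset.card_image_of_injective _ ?_
  intro c c' h
  funext i
  have := Finset.ext_iff.1 h i
  simp at this
  omega

/-- averaging -/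
lemma exists_S {n : ℕ} (D : Finset (Finset (Fin n))) (m s : ℕ) (hm : s ≤ n) :
    ∃ S : Finset (Fin n), S.card = s ∧
      (D.filter (fun T => m ≤ T.card)).card * m.choose s ≤
        n.choose s * (D.filter (fun T => S ⊆ T)).card := by
  by_contra hc
  push Not at hc
  have h1 : ∑ S ∈ (Finset.univ : Finset (Fin n)).powersetCard s, (D.filter (fun T => S ⊆ T)).card
      = ∑ T ∈ D, T.card.choose s := by
    refine (Finset.sum_card_bipartiteAbove_eq_sum_card_bipartiteBelow
      (fun S T : Finset (Fin n) => S ⊆ T)).trans ?_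
    refine Finset.sum_congr rfl fun T _ => ?_
    rw [← Finset.card_powersetCard]
    congr 1
    ext S
    simp [Finset.bipartiteBelow, Finset.mem_powersetCard, and_comm]
  have h2 : (D.filter (fun T => m ≤ T.card)).card * m.choose s ≤ ∑ T ∈ D, T.card.choose s := by
    calc _ = ∑ T ∈ D.filter (fun T => m ≤ T.card), m.choose s := by simp
      _ ≤ ∑ T ∈ D.filter (fun T => m ≤ T.card), T.card.choose s := by
        refine Finset.sum_le_sum fun T hT => Nat.choose_le_choose _ (Finset.mem_filter.1 hT).2
      _ ≤ _ := Finset.sum_le_sum_of_subset (Finset.filter_subset _ _)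
  have hne : ((Finset.univ : Finset (Fin n)).powersetCard s).Nonempty := by
    rw [Finset.powersetCard_nonempty]; simpa
  have h3 := Finset.sum_lt_sum_of_nonempty hne (fun S hS => hc S (Finset.mem_powersetCard.1 hS).2)
  rw [← Finset.mul_sum, h1] at h3
  simp only [Finset.sum_const, Finset.card_powersetCard, Finset.card_univ, Fintype.card_fin,
    smul_eq_mul] at h3
  have := Nat.lt_of_mul_lt_mul_left h3
  omega

lemma binH_eq (p : ℝ) : binH p = Real.binEntropy p / Real.log 2 := by
  unfold binH Real.binEntropy Real.logb
  rw [Real.log_inv, Real.log_inv]; ring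

lemma binH_cont : Continuous binH := by
  have : binH = fun p => Real.binEntropy p / Real.log 2 := funext binH_eq
  rw [this]
  exact Real.binEntropy_continuous.div_const _

lemma binHInv_spec (R : ℝ) (h0 : 0 ≤ R) (h1 : R ≤ 1) :
    0 ≤ binHInv R ∧ binHInv R ≤ 1 / 2 ∧ binH (binHInv R) = R := by
  have hl : 0 < Real.log 2 := Real.log_pos one_lt_two
  have hne : {p : ℝ | 0 ≤ p ∧ p ≤ 1 / 2 ∧ binH p = R}.Nonempty := by
    have := intermediate_value_Icc (show (0:ℝ) ≤ 1/2 by norm_num) binH_cont.continuousOn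
    have hb0 : binH 0 = 0 := by simp [binH_eq]
    have hb1 : binH (1/2) = 1 := by
      rw [binH_eq, one_div, Real.binEntropy_two_inv]; field_simp
    rw [hb0, hb1] at this
    obtain ⟨p, hp, hpR⟩ := this ⟨h0, h1⟩
    exact ⟨p, hp.1, hp.2, hpR⟩
  have hcl : IsClosed {p : ℝ | 0 ≤ p ∧ p ≤ 1 / 2 ∧ binH p = R} := by
    have e : {p : ℝ | 0 ≤ p ∧ p ≤ 1 / 2 ∧ binH p = R} = Set.Icc 0 (1/2) ∩ binH ⁻¹' {R} := by
      ext x; simp [and_assoc]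
    rw [e]
    exact isClosed_Icc.inter (isClosed_singleton.preimage binH_cont)
  have hbd : BddBelow {p : ℝ | 0 ≤ p ∧ p ≤ 1 / 2 ∧ binH p = R} := ⟨0, fun x hx => hx.1⟩
  exact hcl.csInf_mem hne hbd

lemma pow_eq_two (p : ℝ) (hp : 0 < p) (i : ℕ) : p ^ i = (2:ℝ) ^ ((i:ℝ) * Real.logb 2 p) := by
  rw [mul_comm, Real.rpow_mul (by norm_num), Real.rpow_logb (by norm_num) (by norm_num) hp,
    Real.rpow_natCast]

lemma term_eq (p : ℝ) (hp : 0 < p) (hp1 : p < 1) (n i : ℕ) (h : i ≤ n) :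
    p ^ i * (1 - p) ^ (n - i) =
      (2:ℝ) ^ ((i:ℝ) * Real.logb 2 p + ((n:ℝ) - i) * Real.logb 2 (1 - p)) := by
  rw [pow_eq_two p hp, pow_eq_two (1-p) (by linarith), Real.rpow_add (by norm_num), Nat.cast_sub h]

lemma small_sets (p : ℝ) (hp : 0 < p) (hp1 : p ≤ 1/2) (n : ℕ) :
    (((Finset.univ : Finset (Finset (Fin n))).filter (fun T => (T.card : ℝ) < n * p)).card : ℝ)
      ≤ (2:ℝ) ^ ((n:ℝ) * binH p) := by
  have h1 := Fin.sum_pow_mul_eq_add_pow (n := n) p (1 - p)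
  have h2 : ((Finset.univ : Finset (Finset (Fin n))).filter
      (fun T => (T.card : ℝ) < n * p)).card • (2:ℝ) ^ (-((n:ℝ) * binH p)) ≤ 1 := by
    calc _ ≤ ∑ T ∈ (Finset.univ : Finset (Finset (Fin n))).filter (fun T => (T.card : ℝ) < n * p),
        p ^ T.card * (1 - p) ^ (n - T.card) := by
          refine Finset.card_nsmul_le_sum _ _ _ fun T hT => ?_
          have hT := (Finset.mem_filter.1 hT).2
          have hc : T.card ≤ n := by simpa using Finset.card_le_univ T
          rw [term_eq p hp (by linarith) n _ hc]
          refine Real.rpow_le_rpow_of_exponent_le (by norm_num) ?_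
          have hl : Real.logb 2 p ≤ Real.logb 2 (1 - p) :=
            Real.logb_le_logb_of_le (by norm_num) hp (by linarith)
          unfold binH
          nlinarith [mul_nonneg (sub_nonneg.2 hT.le) (sub_nonneg.2 hl)]
      _ ≤ ∑ T : Finset (Fin n), p ^ T.card * (1 - p) ^ (n - T.card) := by
          refine Finset.sum_le_sum_of_subset_of_nonneg (Finset.filter_subset _ _) ?_
          intro T _ _
          have : 0 ≤ 1 - p := by linarith
          positivity
      _ = 1 := by rw [h1]; simp
  rw [nsmul_eq_mul, Real.rpow_neg (by norm_num), ← div_eq_mul_inv,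
    div_le_one (by positivity)] at h2
  exact h2

lemma choose_upper (p : ℝ) (hp : 0 < p) (hp1 : p ≤ 1/2) (n : ℕ) :
    (n.choose ⌈(n:ℝ) * p⌉₊ : ℝ) * p ≤ (2:ℝ) ^ ((n:ℝ) * binH p) := by
  set m := ⌈(n:ℝ) * p⌉₊ with hm
  have hmn : m ≤ n := by
    rw [hm, Nat.ceil_le]
    have : (0:ℝ) ≤ n := n.cast_nonneg
    nlinarith
  have hq : 0 ≤ 1 - p := by linarith
  have h1 : p ^ m * (1-p)^(n-m) * n.choose m ≤ 1 := by
    have := add_pow p (1-p) n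
    rw [show p + (1-p) = 1 by ring, one_pow] at this
    refine le_trans ?_ this.ge
    exact Finset.single_le_sum (f := fun m => p ^ m * (1-p)^(n-m) * (n.choose m : ℝ))
      (fun i _ => by positivity) (Finset.mem_range.2 (Nat.lt_succ_of_le hmn))
  rw [term_eq p hp (by linarith) n m hmn] at h1
  have h2 : (2:ℝ) ^ (-((n:ℝ) * binH p)) * p ≤
      (2:ℝ) ^ ((m:ℝ) * Real.logb 2 p + ((n:ℝ) - m) * Real.logb 2 (1 - p)) := by
    have : p = (2:ℝ) ^ (Real.logb 2 p) := (Real.rpow_logb (by norm_num) (by norm_num) hp).symm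
    have e : (2:ℝ) ^ (-((n:ℝ) * binH p)) * p =
        (2:ℝ) ^ (-((n:ℝ) * binH p) + Real.logb 2 p) := by
      rw [Real.rpow_add (by norm_num), ← this]
    rw [e]
    refine Real.rpow_le_rpow_of_exponent_le (by norm_num) ?_
    have l1 : Real.logb 2 p ≤ 0 := Real.logb_nonpos (by norm_num) hp.le (by linarith)
    have l2 : Real.logb 2 (1-p) ≤ 0 := Real.logb_nonpos (by norm_num) hq (by linarith)
    have c1 : (m:ℝ) ≤ n * p + 1 := (Nat.ceil_lt_add_one (by positivity)).le
    have c2 : n * p ≤ (m:ℝ) := Nat.le_ceil _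
    unfold binH
    nlinarith [mul_nonneg (sub_nonneg.2 c1) (neg_nonneg.2 l1),
      mul_nonneg (sub_nonneg.2 c2) (neg_nonneg.2 l2)]
  have h3 : (2:ℝ) ^ (-((n:ℝ) * binH p)) * p * n.choose m ≤ 1 :=
    (mul_le_mul_of_nonneg_right h2 (by positivity)).trans h1
  rw [Real.rpow_neg (by norm_num), mul_assoc, inv_mul_le_iff₀ (by positivity)] at h3
  linarith

lemma max_term (k x j : ℕ) (hj : j ≤ k + x) :
    (k+x).choose j * k ^ j * x ^ (k + x - j) ≤ (k+x).choose k * k ^ k * x ^ x := by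
  rcases Nat.eq_zero_or_pos x with rfl | hx
  · rcases eq_or_lt_of_le hj with h | h
    · simp at h; subst h; simp
    · have h0 : k + 0 - j ≠ 0 := by omega
      rw [zero_pow h0]; exact Nat.zero_le _
  have hrec : ∀ i, i < k + x → (k+x).choose (i+1) * k ^ (i+1) * x ^ (k+x-(i+1)) * ((i+1) * x) =
      (k+x).choose i * k ^ i * x ^ (k+x-i) * ((k+x-i) * k) := by
    intro i hi
    have e := Nat.choose_succ_right_eq (k+x) i
    have e2 : x ^ (k+x-i) = x ^ (k+x-(i+1)) * x := by
      rw [← pow_succ]; congr 1; omega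
    rw [e2, pow_succ]
    calc _ = ((k+x).choose (i+1) * (i+1)) * (k^i * k * x ^ (k+x-(i+1)) * x) := by ring
      _ = _ := by rw [e]; ring
  have up : ∀ d, d ≤ k → (k+x).choose (k-d) * k ^ (k-d) * x ^ (k + x - (k-d)) ≤
      (k+x).choose k * k ^ k * x ^ x := by
    intro d
    induction d with
    | zero => intro _; simp
    | succ d ih =>
      intro hd
      refine le_trans ?_ (ih (by omega))
      have r := hrec (k-(d+1)) (by omega)
      rw [show k - (d+1) + 1 = k - d by omega] at r
      refine Nat.le_of_mul_le_mul_right (c := (k-d) * x) ?_ (Nat.mul_pos (by omega) hx)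
      rw [r]
      refine Nat.mul_le_mul_left _ ?_
      rw [mul_comm (k-d)]
      exact Nat.mul_le_mul (by omega) (by omega)
  have dn : ∀ d, d ≤ x → (k+x).choose (k+d) * k ^ (k+d) * x ^ (k + x - (k+d)) ≤
      (k+x).choose k * k ^ k * x ^ x := by
    intro d
    induction d with
    | zero => intro _; simp
    | succ d ih =>
      intro hd
      refine le_trans ?_ (ih (by omega))
      have r := hrec (k+d) (by omega)
      rw [show k + d + 1 = k + (d+1) by omega] at r
      refine Nat.le_of_mul_le_mul_right (c := (k+(d+1)) * x) ?_ (Nat.mul_pos (by omega) hx)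
      rw [r]
      refine Nat.mul_le_mul_left _ ?_
      rw [mul_comm (k+(d+1))]
      exact Nat.mul_le_mul (by omega) (by omega)
  rcases le_total j k with h | h
  · have := up (k - j) (by omega)
    rwa [show k - (k - j) = j by omega] at this
  · have := dn (j - k) (by omega)
    rwa [show k + (j - k) = j by omega] at this

lemma choose_lower_nat (k x : ℕ) :
    (k+x)^(k+x) ≤ (k+x+1) * ((k+x).choose k * k ^ k * x ^ x) := by
  rw [add_pow]
  calc _ ≤ ∑ j ∈ Finset.range (k+x+1), (k+x).choose k * k ^ k * x ^ x := by
        refine Finset.sum_le_sum fun j hj => ?_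
        have := max_term k x j (by have := Finset.mem_range.1 hj; omega)
        refine le_trans (le_of_eq ?_) this
        simp; ring
    _ = _ := by simp

lemma pow_self_eq (k N : ℕ) (hN : 0 < N) :
    (k:ℝ)^k = (N:ℝ)^k * (2:ℝ) ^ ((N:ℝ) * (((k:ℝ)/N) * Real.logb 2 ((k:ℝ)/N))) := by
  rcases Nat.eq_zero_or_pos k with rfl | hk
  · simp
  have hN' : (0:ℝ) < N := by exact_mod_cast hN
  have hk' : (0:ℝ) < k := by exact_mod_cast hk
  have : (N:ℝ) * (((k:ℝ)/N) * Real.logb 2 ((k:ℝ)/N)) = k * Real.logb 2 ((k:ℝ)/N) := by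
    field_simp
  rw [this, ← pow_eq_two _ (by positivity), div_pow]
  field_simp

lemma choose_lower (N k : ℕ) (hN : 0 < N) (hk : k ≤ N) :
    (2:ℝ) ^ ((N:ℝ) * binH ((k:ℝ)/N)) ≤ (N+1) * N.choose k := by
  obtain ⟨x, rfl⟩ := Nat.exists_eq_add_of_le hk
  have h := choose_lower_nat k x
  have hN' : (0:ℝ) < ((k + x : ℕ) : ℝ) := by exact_mod_cast hN
  have h' : (((k+x : ℕ) : ℝ))^(k+x) ≤ (((k+x:ℕ):ℝ)+1) * ((k+x).choose k * (k:ℝ) ^ k * (x:ℝ) ^ x) := by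
    exact_mod_cast h
  rw [pow_self_eq k (k+x) hN, pow_self_eq x (k+x) hN, pow_add] at h'
  have e : 1 - (k:ℝ) / ((k+x : ℕ):ℝ) = (x:ℝ) / ((k+x:ℕ):ℝ) := by
    field_simp; push_cast; ring
  unfold binH
  rw [e]
  set M := ((k+x:ℕ):ℝ) with hM
  set A := (k:ℝ)/M * Real.logb 2 ((k:ℝ)/M)
  set B := (x:ℝ)/M * Real.logb 2 ((x:ℝ)/M)
  have hpos : 0 < M^k * M^x := by positivity
  have h3 : 1 ≤ (M+1) * (k+x).choose k * (2:ℝ)^(M * A + M * B) := by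
    rw [Real.rpow_add (by norm_num)]
    refine le_of_mul_le_mul_left ?_ hpos
    linarith
  have h4 := mul_le_mul_of_nonneg_right h3 (show 0 ≤ (2:ℝ)^(M * (-A - B)) by positivity)
  rw [one_mul, mul_assoc, ← Real.rpow_add (by norm_num)] at h4
  have : M * A + M * B + M * (-A - B) = 0 := by ring
  rw [this, Real.rpow_zero, mul_one] at h4
  exact h4

lemma growth (p ε : ℝ) (hp : 0 < p) (hε : 0 < ε) :
    ∀ᶠ n : ℕ in Filter.atTop, (n:ℝ) + 1 ≤ p * ((2:ℝ) ^ ((n:ℝ) * ε) - 1) := by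
  have hr : 1 < (2:ℝ) ^ ε := Real.one_lt_rpow (by norm_num) hε
  have t1 := tendsto_pow_const_div_const_pow_of_one_lt 1 hr
  have t0 := tendsto_pow_const_div_const_pow_of_one_lt 0 hr
  have t := t1.add (t0.const_mul (1 + p))
  rw [mul_zero, add_zero] at t
  filter_upwards [t.eventually (ge_mem_nhds hp)] with n hn
  have hpos : 0 < ((2:ℝ) ^ ε) ^ n := by positivity
  have e : (2:ℝ) ^ ((n:ℝ) * ε) = ((2:ℝ) ^ ε) ^ n := by
    rw [mul_comm, Real.rpow_mul (by norm_num), Real.rpow_natCast]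
  rw [e]
  rw [pow_one, pow_zero, ← mul_div_assoc, ← add_div, div_le_iff₀ hpos] at hn
  linarith

lemma entropy_lim (p α δ : ℝ) (hα : 0 ≤ α) (hαp : α ≤ p) (hp : p ≤ 1/2) (hδ : 0 < δ) :
    ∀ᶠ n : ℕ in Filter.atTop,
      (n:ℝ) * ((1 - α) * binH ((p - α) / (1 - α)) - δ) ≤
        ((n:ℝ) - ⌈(n:ℝ) * α⌉₊) *
          binH (((⌈(n:ℝ) * p⌉₊ : ℝ) - ⌈(n:ℝ) * α⌉₊) / ((n:ℝ) - ⌈(n:ℝ) * α⌉₊)) := by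
  have hc : ∀ a : ℝ, 0 ≤ a → Filter.Tendsto (fun n : ℕ => (⌈(n:ℝ) * a⌉₊ : ℝ) / n) Filter.atTop
      (nhds a) := by
    intro a ha
    have := (tendsto_nat_ceil_mul_div_atTop ha).comp (tendsto_natCast_atTop_atTop (R := ℝ))
    refine this.congr fun n => ?_
    simp [mul_comm]
  have ta := hc α hα
  have tp := hc p (hα.trans hαp)
  have t1 := ta.const_sub 1
  have t2 := (tp.sub ta).div t1 (by linarith)
  have t3 := t1.mul ((binH_cont.tendsto _).comp t2)
  filter_upwards [t3.eventually (le_mem_nhds (show (1 - α) * binH ((p - α) / (1 - α)) - δ <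
    (1 - α) * binH ((p - α) / (1 - α)) by linarith)), Filter.eventually_gt_atTop 0] with n hn hn0
  have hn' : (0:ℝ) < n := by exact_mod_cast hn0
  have := mul_le_mul_of_nonneg_left hn hn'.le
  refine this.trans (le_of_eq ?_)
  simp only [Function.comp, Pi.div_apply]
  rw [← mul_assoc, mul_sub, mul_one, mul_div_cancel₀ _ hn'.ne']
  congr 2
  rw [← sub_div, one_sub_div hn'.ne', div_div_div_cancel_right₀ hn'.ne']

/-- Any codebook of size at least `2^{n(R + ε)}` admits, for `n` large enough, a subset of
cardinality at least `nα` that is `⌈2^{nβ}⌉`-shattered, where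
`β = (1-α)·h((h⁻¹(R)-α)/(1-α))`. -/
theorem soft_shattering_corollary (R ε α : ℝ) (hR0 : 0 < R) (hR1 : R ≤ 1) (hε : 0 < ε)
    (hα0 : 0 ≤ α) (hα1 : α ≤ binHInv R) :
    ∃ N : ℕ, ∀ n : ℕ, N ≤ n → ∀ C : Finset (Fin n → Fin 2),
      (2 : ℝ) ^ ((n : ℝ) * (R + ε)) ≤ C.card →
      ∃ S : Finset (Fin n), (n : ℝ) * α ≤ S.card ∧
        KShatters (⌈(2 : ℝ) ^ ((n : ℝ) * ((1 - α) * binH ((binHInv R - α) / (1 - α))))⌉₊)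
          C S := by
  obtain ⟨hp0, hp1, hpR⟩ := binHInv_spec R hR0.le hR1
  set p := binHInv R with hpdef
  have hp : 0 < p := by
    rcases hp0.eq_or_lt with h | h
    · rw [← h] at hpR
      simp [binH_eq] at hpR
      linarith
    · exact h
  set β := (1 - α) * binH ((p - α) / (1 - α)) with hβ
  have ev := (growth p (ε/2) hp (by linarith)).and
    ((entropy_lim p α (ε/2) hα0 hα1 hp1 (by linarith)).and (Filter.eventually_ge_atTop 2))
  obtain ⟨N, hN⟩ := Filter.eventually_atTop.1 ev
  refine ⟨N, fun n hn C hC => ?_⟩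
  obtain ⟨g1, g2, hn2⟩ := hN n hn
  rw [← hβ] at g2
  have hn2' : (2:ℝ) ≤ n := by exact_mod_cast hn2
  set m := ⌈(n:ℝ) * p⌉₊ with hm
  set s := ⌈(n:ℝ) * α⌉₊ with hs
  have hsm : s ≤ m := Nat.ceil_mono (mul_le_mul_of_nonneg_left hα1 (by linarith))
  have hmn : m ≤ n := by
    rw [hm, Nat.ceil_le]
    nlinarith
  have hsn : s < n := by
    have : (s:ℝ) < n * α + 1 := Nat.ceil_lt_add_one (by positivity)
    have h3 : (s:ℝ) < n := by nlinarith
    exact_mod_cast h3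
  obtain ⟨D, hD1, hD2, hD3⟩ := exists_down (α := Fin n) _
    (C.image (fun c : Fin n → Fin 2 => Finset.univ.filter (fun i : Fin n => c i = 1))) rfl
  rw [card_toSets] at hD1
  obtain ⟨S, hS1, hS2⟩ := exists_S D m s hsn.le
  refine ⟨S, ?_, kshatters_of_setSh _ _ _ (hD3 _ _ (setSh_mono ?_ _ _ (down_sh D hD2 S)))⟩
  · rw [hS1]; exact Nat.le_ceil _
  rw [Nat.ceil_le]
  set K := (D.filter (fun T => S ⊆ T)).card
  set G := (D.filter (fun T => m ≤ T.card)).card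
  -- large sets
  have hG : (2:ℝ) ^ ((n:ℝ) * (R + ε)) - (2:ℝ) ^ ((n:ℝ) * R) ≤ G := by
    have h1 := Finset.card_filter_add_card_filter_not (s := D) (fun T => m ≤ T.card)
    have h2 : (D.filter (fun T => ¬ m ≤ T.card)).card ≤
        ((Finset.univ : Finset (Finset (Fin n))).filter (fun T => (T.card : ℝ) < n * p)).card := by
      refine Finset.card_le_card fun T hT => ?_
      have := (Finset.mem_filter.1 hT).2
      rw [hm, Nat.ceil_le, not_le] at this
      exact Finset.mem_filter.2 ⟨Finset.mem_univ _, this⟩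
    have h3 := small_sets p hp hp1 n
    rw [hpR] at h3
    have h4 : (G:ℝ) + ((D.filter (fun T => ¬ m ≤ T.card)).card : ℝ) = C.card := by
      rw [← hD1]; exact_mod_cast h1
    have h5 := (Nat.cast_le (α := ℝ)).2 h2
    linarith
  have hK : G * (n-s).choose (m-s) ≤ n.choose m * K := by
    have h1 := Nat.choose_mul (n := n) hsm
    refine Nat.le_of_mul_le_mul_left (c := n.choose s) ?_ (Nat.choose_pos hsn.le)
    calc n.choose s * (G * (n-s).choose (m-s)) = n.choose m * (G * m.choose s) := by
          rw [mul_left_comm, ← h1]; ring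
      _ ≤ n.choose m * (n.choose s * K) := Nat.mul_le_mul_left _ hS2
      _ = _ := by ring
  have hK' : (G:ℝ) * (n-s).choose (m-s) ≤ n.choose m * K := by exact_mod_cast hK
  have hu := choose_upper p hp hp1 n
  rw [hpR, ← hm] at hu
  have hl := choose_lower (n-s) (m-s) (by omega) (by omega)
  rw [Nat.cast_sub hsm, Nat.cast_sub hsn.le] at hl
  set X := ((n-s).choose (m-s) : ℝ) with hX
  have hX0 : 0 ≤ X := by positivity
  have hl2 : (2:ℝ) ^ ((n:ℝ) * (β - ε/2)) ≤ (n+1) * X := by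
    refine (Real.rpow_le_rpow_of_exponent_le (by norm_num) g2).trans (hl.trans ?_)
    refine mul_le_mul_of_nonneg_right ?_ hX0
    have : (0:ℝ) ≤ s := by positivity
    linarith
  set Q := (2:ℝ) ^ ((n:ℝ) * R) with hQ
  have hQ0 : 0 < Q := by positivity
  set E := (2:ℝ) ^ ((n:ℝ) * (ε/2)) with hE
  have hE1 : 1 ≤ E := Real.one_le_rpow (by norm_num) (by positivity)
  have e1 : (2:ℝ) ^ ((n:ℝ) * (R + ε)) = Q * (E * E) := by
    rw [hQ, hE, ← Real.rpow_add (by norm_num), ← Real.rpow_add (by norm_num)]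
    congr 1; ring
  have e2 : (2:ℝ) ^ ((n:ℝ) * β) = (2:ℝ) ^ ((n:ℝ) * (β - ε/2)) * E := by
    rw [hE, ← Real.rpow_add (by norm_num)]
    congr 1; ring
  rw [e1] at hG
  rw [e2]
  have hKlow : p * (E * E - 1) * X ≤ K := by
    refine le_of_mul_le_mul_left ?_ hQ0
    calc Q * (p * (E * E - 1) * X) = p * ((Q * (E * E) - Q) * X) := by ring
      _ ≤ p * (G * X) := by gcongr
      _ ≤ p * (n.choose m * K) := by gcongr
      _ = (n.choose m * p) * K := by ring
      _ ≤ Q * K := by gcongr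
  calc (2:ℝ) ^ ((n:ℝ) * (β - ε/2)) * E ≤ ((n+1) * X) * E := by gcongr
    _ ≤ (p * (E - 1) * X) * E := by gcongr
    _ = p * (E * E - E) * X := by ring
    _ ≤ p * (E * E - 1) * X := by gcongr
    _ ≤ K := hKlow
end

section
/- Any admissible rate triplet (r0,r1,r2) for the zero-error binary adder channel with an additional common message satisfies r0 + r1 + r2 ≤ max over η ∈ [0,1/2] of min{ h(η) + 1 − η, 2h(½(1−√(1−2η))) − η + r0 }. -/
/-- A family of codebook pairs forms a zero-error system: the map
`(i, a, b) ↦ a + b` is injective on the disjoint union of the `C1 i × C2 i`. -/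
def ZeroErrorSystem {n M0 : ℕ} (C1 C2 : Fin M0 → Finset (Fin n → Fin 2)) : Prop :=
  Set.InjOn
    (fun p : Fin M0 × (Fin n → Fin 2) × (Fin n → Fin 2) =>
      fun i : Fin n => (p.2.1 i : ℕ) + (p.2.2 i : ℕ))
    {p : Fin M0 × (Fin n → Fin 2) × (Fin n → Fin 2) | p.2.1 ∈ C1 p.1 ∧ p.2.2 ∈ C2 p.1}

/-- `(r0, r1, r2)` is admissible for the zero-error binary adder channel with an
additional common message. -/
def AdmissibleTriplet (r0 r1 r2 : ℝ) : Prop :=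
  0 ≤ r0 ∧ 0 ≤ r1 ∧ 0 ≤ r2 ∧
    ∀ ε : ℝ, 0 < ε → ∀ N : ℕ, ∃ n : ℕ, N ≤ n ∧
      ∃ M0 M1 M2 : ℕ, ∃ C1 C2 : Fin M0 → Finset (Fin n → Fin 2),
        (∀ i, (C1 i).card = M1) ∧ (∀ i, (C2 i).card = M2) ∧ ZeroErrorSystem C1 C2 ∧
        (2 : ℝ) ^ ((n : ℝ) * (r0 - ε)) ≤ M0 ∧
        (2 : ℝ) ^ ((n : ℝ) * (r1 - ε)) ≤ M1 ∧
        (2 : ℝ) ^ ((n : ℝ) * (r2 - ε)) ≤ M2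

section

open Finset

theorem aux_gibbs (P Q : ℕ → ℝ) (hP : ∀ a ∈ range 3, 0 ≤ P a) (hP1 : ∑ a ∈ range 3, P a = 1)
    (hQ : ∀ a ∈ range 3, 0 ≤ Q a) (hQ1 : ∑ a ∈ range 3, Q a ≤ 1)
    (h0 : ∀ a ∈ range 3, Q a = 0 → P a = 0) :
    ∑ a ∈ range 3, Real.negMulLog (P a) ≤ - ∑ a ∈ range 3, P a * Real.log (Q a) := by
  have key : ∀ a ∈ range 3, Real.negMulLog (P a) ≤ - (P a * Real.log (Q a)) + (Q a - P a) := by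
    intro a ha
    rcases (hP a ha).eq_or_lt with h | h
    · rw [← h]; simp [hQ a ha]
    · have hq : 0 < Q a := lt_of_le_of_ne (hQ a ha) (fun e => by
        have := h0 a ha e.symm; linarith)
      have := Real.log_le_sub_one_of_pos (div_pos hq h)
      rw [Real.log_div hq.ne' h.ne'] at this
      have h2 := mul_le_mul_of_nonneg_left this h.le
      have h3 : P a * (Q a / P a - 1) = Q a - P a := by field_simp
      rw [h3] at h2
      unfold Real.negMulLog
      linarith
  have := sum_le_sum key
  rw [sum_add_distrib, sum_neg_distrib, sum_sub_distrib] at this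
  linarith

/-- empirical frequency -/
noncomputable def auxP {τ : Type*} {n : ℕ} (T : Finset τ) (f : τ → Fin n → ℕ) (j : Fin n) (a : ℕ) : ℝ :=
  (#{t ∈ T | f t j = a} : ℝ) / #T

theorem auxP_nonneg {τ : Type*} {n : ℕ} (T : Finset τ) (f : τ → Fin n → ℕ) (j : Fin n) (a : ℕ) :
    0 ≤ auxP T f j a := by unfold auxP; positivity

theorem auxP_sum {τ : Type*} {n : ℕ} (T : Finset τ) (hT : T.Nonempty) (f : τ → Fin n → ℕ)
    (hf : ∀ t ∈ T, ∀ j, f t j ∈ range 3) (j : Fin n) : ∑ a ∈ range 3, auxP T f j a = 1 := by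
  unfold auxP
  rw [← sum_div]
  have := card_eq_sum_card_fiberwise (f := fun t => f t j) (s := T) (t := range 3)
    (fun t ht => hf t ht j)
  rw [this]
  push_cast
  apply div_self
  have h : 0 < #T := hT.card_pos
  rw [this] at h
  exact_mod_cast h.ne'

theorem aux_subadd {τ : Type*} {n : ℕ} (T : Finset τ) (hT : T.Nonempty) (f : τ → Fin n → ℕ)
    (hf : ∀ t ∈ T, ∀ j, f t j ∈ range 3) (hinj : Set.InjOn f T) :
    Real.log #T ≤ ∑ j, ∑ a ∈ range 3, Real.negMulLog (auxP T f j a) := by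
  classical
  have hc : (0 : ℝ) < #T := by exact_mod_cast hT.card_pos
  have hpos : ∀ t ∈ T, ∀ j, 0 < auxP T f j (f t j) := by
    intro t ht j
    unfold auxP
    apply div_pos _ hc
    exact_mod_cast card_pos.mpr ⟨t, by simp [ht]⟩
  have hsum : ∑ t ∈ T, ∏ j, auxP T f j (f t j) ≤ 1 := by
    calc ∑ t ∈ T, ∏ j, auxP T f j (f t j)
        = ∑ z ∈ T.image f, ∏ j, auxP T f j (z j) := by
          rw [sum_image]; exact hinj
      _ ≤ ∑ z ∈ Fintype.piFinset (fun _ : Fin n => range 3), ∏ j, auxP T f j (z j) := by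
          apply sum_le_sum_of_subset_of_nonneg
          · intro z hz
            obtain ⟨t, ht, rfl⟩ := mem_image.mp hz
            exact Fintype.mem_piFinset.mpr (hf t ht)
          · intros; exact prod_nonneg (fun _ _ => auxP_nonneg _ _ _ _)
      _ = ∏ j, ∑ a ∈ range 3, auxP T f j a := (prod_univ_sum _ _).symm
      _ = 1 := by simp only [auxP_sum T hT f hf, prod_const_one]
  have h1 : ∀ t ∈ T, Real.log #T + ∑ j, Real.log (auxP T f j (f t j)) ≤
      #T * (∏ j, auxP T f j (f t j)) - 1 := by
    intro t ht
    have hp : 0 < ∏ j, auxP T f j (f t j) := prod_pos (fun j _ => hpos t ht j)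
    rw [← Real.log_prod (fun j _ => (hpos t ht j).ne'), ← Real.log_mul hc.ne' hp.ne']
    exact Real.log_le_sub_one_of_pos (mul_pos hc hp)
  have h2 := sum_le_sum h1
  rw [sum_add_distrib, sum_sub_distrib, ← mul_sum, sum_const, sum_const, nsmul_eq_mul, nsmul_eq_mul,
    sum_comm] at h2
  have h3 : ∀ j, ∑ t ∈ T, Real.log (auxP T f j (f t j)) =
      - (#T * ∑ a ∈ range 3, Real.negMulLog (auxP T f j a)) := by
    intro j
    rw [← sum_fiberwise_of_maps_to (fun t ht => hf t ht j), mul_sum, ← sum_neg_distrib]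
    apply sum_congr rfl
    intro a _
    rw [sum_congr rfl (g := fun _ => Real.log (auxP T f j a))]
    · rw [sum_const, nsmul_eq_mul, Real.negMulLog]
      have : (#{t ∈ T | f t j = a} : ℝ) = #T * auxP T f j a := by unfold auxP; field_simp
      rw [this]; ring
    · intro t ht
      rw [(mem_filter.mp ht).2]
  simp only [h3] at h2
  rw [sum_neg_distrib, ← mul_sum] at h2
  have h4 : (#T : ℝ) * (∑ t ∈ T, ∏ j, auxP T f j (f t j)) ≤ #T * 1 :=
    mul_le_mul_of_nonneg_left hsum hc.le
  have h5 : (#T : ℝ) * Real.log #T ≤ #T * ∑ j, ∑ a ∈ range 3, Real.negMulLog (auxP T f j a) := by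
    linarith
  exact le_of_mul_le_mul_left h5 hc

theorem aux_C1 (P : ℕ → ℝ) (hP : ∀ a ∈ range 3, 0 ≤ P a) (hP1 : ∑ a ∈ range 3, P a = 1) :
    ∑ a ∈ range 3, Real.negMulLog (P a) ≤ Real.binEntropy (P 1) + (1 - P 1) * Real.log 2 := by
  have p0 := hP 0 (by simp)
  have p1 := hP 1 (by simp)
  have p2 := hP 2 (by simp)
  have hs := hP1
  simp only [sum_range_succ, range_zero, sum_empty, zero_add] at hs
  by_cases h : P 1 = 1
  · have e0 : P 0 = 0 := by linarith
    have e2 : P 2 = 0 := by linarith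
    simp [sum_range_succ, h, e0, e2]
  have hlt : 0 < 1 - P 1 := by
    rcases lt_or_gt_of_ne h with h | h <;> linarith
  have := aux_gibbs P (fun a => if a = 1 then P 1 else (1 - P 1) / 2) hP hP1 (by
      intro a _; split_ifs <;> linarith) (by
      simp [sum_range_succ]; linarith) (by
      intro a _ h
      split_ifs at h with h1
      · rw [h1, h]
      · linarith)
  refine this.trans (le_of_eq ?_)
  simp [sum_range_succ, Real.binEntropy_eq_negMulLog_add_negMulLog_one_sub, Real.negMulLog]
  rw [Real.log_div hlt.ne' (by norm_num)]
  have : P 2 = 1 - P 1 - P 0 := by linarith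
  rw [this]; ring

noncomputable def auxR (x : ℝ) : ℝ := 1 / 2 * (1 - Real.sqrt (1 - 2 * x))

theorem aux_C2' (P : ℕ → ℝ) (p q : ℝ) (hp0 : 0 ≤ p) (hp1 : p ≤ 1) (hq0 : 0 ≤ q) (hq1 : q ≤ 1)
    (hpq : p + q ≤ 1)
    (h0 : P 0 = (1 - p) * (1 - q)) (h1 : P 1 = p + q - 2 * p * q) (h2 : P 2 = p * q) :
    ∑ a ∈ range 3, Real.negMulLog (P a) ≤ 2 * Real.binEntropy (auxR (P 1)) - P 1 * Real.log 2 := by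
  have hr : p + q ≤ 2 * auxR (P 1) := by
    have : Real.sqrt (1 - 2 * P 1) ≤ 1 - p - q := by
      rw [Real.sqrt_le_left (by linarith), h1]
      nlinarith [sq_nonneg (p - q)]
    unfold auxR; linarith
  have hr2 : auxR (P 1) ≤ 1 / 2 := by
    unfold auxR; linarith [Real.sqrt_nonneg (1 - 2 * P 1)]
  generalize auxR (P 1) = r at *
  rcases (show 0 ≤ r by linarith).eq_or_lt with h | h
  · have e1 : p = 0 := by linarith
    have e2 : q = 0 := by linarith
    subst e1 e2
    simp [sum_range_succ, h0, h1, h2, ← h]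
  have hP : ∀ a ∈ range 3, 0 ≤ P a := by
    intro a ha
    have : a < 3 := by simpa using ha
    interval_cases a
    · rw [h0]; exact mul_nonneg (by linarith) (by linarith)
    · rw [h1]; nlinarith
    · rw [h2]; positivity
  have h1r : 0 < 1 - r := by linarith
  have := aux_gibbs P (fun a => if a = 0 then (1 - r)^2 else if a = 1 then 2 * r * (1 - r) else r ^ 2)
    hP (by simp only [sum_range_succ, range_zero, sum_empty, h0, h1, h2]; ring)
    (by intro a _; split_ifs <;> positivity)
    (by simp [sum_range_succ]; nlinarith)
    (by
      intro a _ h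
      exfalso; revert h
      split_ifs <;> positivity)
  refine this.trans ?_
  simp [sum_range_succ, Real.binEntropy_eq_negMulLog_add_negMulLog_one_sub, Real.negMulLog]
  rw [Real.log_mul (by positivity) (by positivity), Real.log_mul (by positivity) (by positivity),
    h0, h1, h2]
  have hl : Real.log r ≤ Real.log (1 - r) := Real.log_le_log h (by linarith)
  nlinarith [mul_nonneg (sub_nonneg.mpr hr) (sub_nonneg.mpr hl)]

theorem aux_C2 (P : ℕ → ℝ) (p q : ℝ) (hp0 : 0 ≤ p) (hp1 : p ≤ 1) (hq0 : 0 ≤ q) (hq1 : q ≤ 1)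
    (h0 : P 0 = (1 - p) * (1 - q)) (h1 : P 1 = p + q - 2 * p * q) (h2 : P 2 = p * q) :
    ∑ a ∈ range 3, Real.negMulLog (P a) ≤ 2 * Real.binEntropy (auxR (P 1)) - P 1 * Real.log 2 := by
  rcases le_total (p + q) 1 with h | h
  · exact aux_C2' P p q hp0 hp1 hq0 hq1 h h0 h1 h2
  · have := aux_C2' (fun a => P (2 - a)) (1 - p) (1 - q) (by linarith) (by linarith) (by linarith)
      (by linarith) (by linarith) (by simp [h2]) (by simp only [Nat.reduceSub, h1]; ring)
      (by simp [h0])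
    refine le_trans (le_of_eq ?_) this
    simp [sum_range_succ]; ring

theorem aux_L {a b : ℝ} (ha : 0 ≤ a) (hab : a ≤ b) (hb : b < 1) :
    b * (Real.log (1 + a) - Real.log (1 - a)) ≤ a * (Real.log (1 + b) - Real.log (1 - b)) := by
  have h1 := (Real.hasSum_log_sub_log_of_abs_lt_one (x := a) (by rw [abs_of_nonneg ha]; linarith)).mul_left b
  have h2 := (Real.hasSum_log_sub_log_of_abs_lt_one (x := b) (by rw [abs_of_nonneg (ha.trans hab)]; linarith)).mul_left a
  refine hasSum_le (fun k => ?_) h1 h2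
  have hb0 := ha.trans hab
  have : a ^ (2 * k) ≤ b ^ (2 * k) := pow_le_pow_left₀ ha hab _
  have h3 : 0 ≤ 2 * (1 / (2 * (k : ℝ) + 1)) * (a * b) := by positivity
  have := mul_le_mul_of_nonneg_left this h3
  calc _ = 2 * (1 / (2 * (k : ℝ) + 1)) * (a * b) * a ^ (2 * k) := by ring
    _ ≤ _ := this
    _ = _ := by ring

theorem aux_R_mem {x : ℝ} (hx : 0 ≤ x) : auxR x ∈ Set.Icc (0 : ℝ) 2⁻¹ := by
  have := Real.sqrt_nonneg (1 - 2 * x)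
  have : Real.sqrt (1 - 2 * x) ≤ 1 := by rw [Real.sqrt_le_left zero_le_one]; linarith
  unfold auxR
  constructor <;> linarith

theorem aux_R_mono {x y : ℝ} (hxy : x ≤ y) : auxR x ≤ auxR y := by
  have : Real.sqrt (1 - 2 * y) ≤ Real.sqrt (1 - 2 * x) := Real.sqrt_le_sqrt (by linarith)
  unfold auxR; linarith

theorem aux_K_mono {x y : ℝ} (hx : 0 ≤ x) (hxy : x ≤ y) :
    Real.binEntropy (auxR x) ≤ Real.binEntropy (auxR y) :=
  Real.binEntropy_strictMonoOn.monotoneOn (aux_R_mem hx) (aux_R_mem (hx.trans hxy)) (aux_R_mono hxy)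

theorem aux_K_min (x : ℝ) : Real.binEntropy (auxR (min x (1/2))) = Real.binEntropy (auxR x) := by
  rcases le_total x (1/2) with h | h
  · rw [min_eq_left h]
  · rw [min_eq_right h]
    congr 1
    unfold auxR
    rw [Real.sqrt_eq_zero_of_nonpos (by linarith), Real.sqrt_eq_zero_of_nonpos (by linarith)]

theorem aux_K_deriv {x : ℝ} (hx0 : 0 < x) (hx1 : x < 1/2) :
    HasDerivAt (fun x => Real.binEntropy (auxR x))
      ((Real.log (1 + √(1 - 2 * x)) - Real.log (1 - √(1 - 2 * x))) / (2 * √(1 - 2 * x))) x := by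
  have hs : 0 < √(1 - 2 * x) := Real.sqrt_pos.mpr (by linarith)
  have hs1 : √(1 - 2 * x) < 1 := by
    rw [Real.sqrt_lt' one_pos]; linarith
  have hR : HasDerivAt auxR (1 / (2 * √(1 - 2 * x))) x := by
    have h1 : HasDerivAt (fun x : ℝ => 1 - 2 * x) (-2) x := by
      simpa using ((hasDerivAt_id x).const_mul 2).const_sub 1
    have h2 := ((h1.sqrt (by linarith)).const_sub 1).const_mul (1/2)
    refine h2.congr_deriv ?_
    field_simp
  have hR0 : auxR x ≠ 0 := by unfold auxR; intro h; linarith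
  have hR1 : auxR x ≠ 1 := by unfold auxR; intro h; linarith
  have := (Real.hasDerivAt_binEntropy hR0 hR1).comp x hR
  refine this.congr_deriv ?_
  have e1 : 1 - auxR x = (1 + √(1 - 2 * x)) / 2 := by unfold auxR; ring
  have e2 : auxR x = (1 - √(1 - 2 * x)) / 2 := by unfold auxR; ring
  rw [e1, e2, Real.log_div (by linarith) (by norm_num), Real.log_div (by linarith) (by norm_num)]
  ring

theorem aux_K_concave : ConcaveOn ℝ (Set.Icc (0:ℝ) (1/2)) (fun x => Real.binEntropy (auxR x)) := by
  apply AntitoneOn.concaveOn_of_deriv (convex_Icc _ _)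
  · apply Continuous.continuousOn
    apply Real.binEntropy_continuous.comp
    unfold auxR
    fun_prop
  · intro x hx
    rw [interior_Icc] at hx
    exact (aux_K_deriv hx.1 hx.2).differentiableAt.differentiableWithinAt
  · rw [interior_Icc]
    intro x hx y hy hxy
    rw [(aux_K_deriv hx.1 hx.2).deriv, (aux_K_deriv hy.1 hy.2).deriv]
    have hsx : 0 < √(1 - 2 * x) := Real.sqrt_pos.mpr (by linarith [hx.2])
    have hsy : 0 < √(1 - 2 * y) := Real.sqrt_pos.mpr (by linarith [hy.2])
    have hsx1 : √(1 - 2 * x) < 1 := by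
      rw [Real.sqrt_lt' one_pos]; linarith [hx.1]
    have := aux_L hsy.le (Real.sqrt_le_sqrt (by linarith : 1 - 2 * y ≤ 1 - 2 * x)) hsx1
    rw [div_le_div_iff₀ (by positivity) (by positivity)]
    linarith

theorem aux_K_jensen {ι : Type*} (s : Finset ι) (hs : s.Nonempty) (x : ι → ℝ) (hx : ∀ i ∈ s, 0 ≤ x i) :
    (∑ i ∈ s, Real.binEntropy (auxR (x i))) ≤ #s * Real.binEntropy (auxR ((∑ i ∈ s, x i) / #s)) := by
  have hc : (0:ℝ) < #s := by exact_mod_cast hs.card_pos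
  have := aux_K_concave.le_map_sum (t := s) (w := fun _ => 1 / (#s : ℝ)) (p := fun i => min (x i) (1/2))
    (fun _ _ => by positivity) (by simp [hc.ne'])
    (fun i hi => ⟨le_min (hx i hi) (by norm_num), min_le_right _ _⟩)
  simp only [aux_K_min, smul_eq_mul, ← mul_sum] at this
  have h2 : Real.binEntropy (auxR (1 / (#s:ℝ) * ∑ i ∈ s, min (x i) (1/2))) ≤
      Real.binEntropy (auxR ((∑ i ∈ s, x i) / #s)) := by
    apply aux_K_mono
    · exact mul_nonneg (by positivity) (sum_nonneg fun i hi => le_min (hx i hi) (by norm_num))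
    · rw [one_div, inv_mul_eq_div]
      gcongr
      exact min_le_left _ _
  have h3 := this.trans h2
  rw [one_div, inv_mul_eq_div, div_le_iff₀ hc] at h3
  linarith

theorem aux_h_jensen {ι : Type*} (s : Finset ι) (hs : s.Nonempty) (x : ι → ℝ)
    (hx : ∀ i ∈ s, x i ∈ Set.Icc (0:ℝ) 1) :
    (∑ i ∈ s, Real.binEntropy (x i)) ≤ #s * Real.binEntropy ((∑ i ∈ s, x i) / #s) := by
  have hc : (0:ℝ) < #s := by exact_mod_cast hs.card_pos
  have := Real.strictConcave_binEntropy.concaveOn.le_map_sum (t := s) (w := fun _ => 1 / (#s : ℝ)) (p := x)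
    (fun _ _ => by positivity) (by simp [hc.ne']) hx
  simp only [smul_eq_mul, ← mul_sum] at this
  rw [one_div, inv_mul_eq_div, inv_mul_eq_div, div_le_iff₀ hc] at this
  linarith

/-- coordinatewise sum -/
def auxG {n : ℕ} (t : (Fin n → Fin 2) × (Fin n → Fin 2)) (j : Fin n) : ℕ :=
  (t.1 j : ℕ) + (t.2 j : ℕ)

theorem auxG_mem {n : ℕ} (t : (Fin n → Fin 2) × (Fin n → Fin 2)) (j : Fin n) :
    auxG t j ∈ range 3 := by
  unfold auxG
  rw [mem_range]; omega

theorem aux_pair {n : ℕ} (A B : Finset (Fin n → Fin 2)) (hA : A.Nonempty) (hB : B.Nonempty)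
    (j : Fin n) : ∑ a ∈ range 3, Real.negMulLog (auxP (A ×ˢ B) auxG j a) ≤
      2 * Real.binEntropy (auxR (auxP (A ×ˢ B) auxG j 1)) - auxP (A ×ˢ B) auxG j 1 * Real.log 2 := by
  have ha : (0 : ℝ) < #A := by exact_mod_cast hA.card_pos
  have hb : (0 : ℝ) < #B := by exact_mod_cast hB.card_pos
  have key : ∀ S : Finset (Fin n → Fin 2), (#{v ∈ S | v j = 0} : ℝ) = #S - #{v ∈ S | v j = 1} := by
    intro S
    have := card_filter_add_card_filter_not (s := S) (fun v => v j = 1)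
    have e : #{v ∈ S | ¬ v j = 1} = #{v ∈ S | v j = 0} := by
      congr 1; apply filter_congr; intro v _; omega
    rw [e] at this
    rw [← this]; push_cast; ring
  have le : ∀ S : Finset (Fin n → Fin 2), (#{v ∈ S | v j = 1} : ℝ) ≤ #S := by
    intro S; exact_mod_cast card_filter_le _ _
  have e0 : auxP (A ×ˢ B) auxG j 0 =
      (1 - (#{v ∈ A | v j = 1} : ℝ) / #A) * (1 - (#{v ∈ B | v j = 1} : ℝ) / #B) := by
    have : {t ∈ A ×ˢ B | auxG t j = 0} = {v ∈ A | v j = 0} ×ˢ {v ∈ B | v j = 0} := by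
      rw [← filter_product]; apply filter_congr; intro v _; unfold auxG; omega
    unfold auxP
    rw [this, card_product, card_product]; push_cast
    rw [key A, key B]; field_simp
  have e2 : auxP (A ×ˢ B) auxG j 2 =
      ((#{v ∈ A | v j = 1} : ℝ) / #A) * ((#{v ∈ B | v j = 1} : ℝ) / #B) := by
    have : {t ∈ A ×ˢ B | auxG t j = 2} = {v ∈ A | v j = 1} ×ˢ {v ∈ B | v j = 1} := by
      rw [← filter_product]; apply filter_congr; intro v _; unfold auxG; omega
    unfold auxP
    rw [this, card_product, card_product]; push_cast
    field_simp
  have hs := auxP_sum (A ×ˢ B) (hA.product hB) auxG (fun t _ j => auxG_mem t j) j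
  simp only [sum_range_succ, range_zero, sum_empty, zero_add] at hs
  refine aux_C2 (auxP (A ×ˢ B) auxG j) ((#{v ∈ A | v j = 1} : ℝ) / #A)
    ((#{v ∈ B | v j = 1} : ℝ) / #B) (by positivity) ((div_le_one ha).mpr (le A)) (by positivity)
    ((div_le_one hb).mpr (le B)) e0 ?_ e2
  rw [e0, e2] at hs
  linarith

theorem auxP_le_one {τ : Type*} {n : ℕ} (T : Finset τ) (f : τ → Fin n → ℕ) (j : Fin n) (a : ℕ) :
    auxP T f j a ≤ 1 := by
  unfold auxP
  apply div_le_one_of_le₀ _ (by positivity)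
  exact_mod_cast card_filter_le _ _

theorem aux_main {n M0 M1 M2 : ℕ} (hn : 0 < n) (h0 : 0 < M0) (h1 : 0 < M1) (h2 : 0 < M2)
    (C1 C2 : Fin M0 → Finset (Fin n → Fin 2)) (hc1 : ∀ i, #(C1 i) = M1) (hc2 : ∀ i, #(C2 i) = M2)
    (hz : ZeroErrorSystem C1 C2) :
    ∃ η ∈ Set.Icc (0 : ℝ) 1,
      Real.log (M0 * (M1 * M2)) ≤ n * (Real.binEntropy η + (1 - η) * Real.log 2) ∧
      Real.log (M1 * M2) ≤ n * (2 * Real.binEntropy (auxR η) - η * Real.log 2) := by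
  have hnR : (0 : ℝ) < n := by exact_mod_cast hn
  have h0R : (0 : ℝ) < M0 := by exact_mod_cast h0
  have h1R : (0 : ℝ) < M1 := by exact_mod_cast h1
  have h2R : (0 : ℝ) < M2 := by exact_mod_cast h2
  have : Nonempty (Fin n) := ⟨⟨0, hn⟩⟩
  have : Nonempty (Fin M0) := ⟨⟨0, h0⟩⟩
  have ne1 : ∀ i, (C1 i).Nonempty := fun i => card_pos.mp (by rw [hc1]; exact h1)
  have ne2 : ∀ i, (C2 i).Nonempty := fun i => card_pos.mp (by rw [hc2]; exact h2)
  set x : Fin M0 × Fin n → ℝ := fun k => auxP (C1 k.1 ×ˢ C2 k.1) auxG k.2 1 with hx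
  have hx0 : ∀ k, 0 ≤ x k := fun k => auxP_nonneg _ _ _ _
  have hx1 : ∀ k, x k ≤ 1 := fun k => auxP_le_one _ _ _ _
  have hcard : (#(univ : Finset (Fin M0 × Fin n)) : ℝ) = M0 * n := by
    rw [card_univ, Fintype.card_prod, Fintype.card_fin, Fintype.card_fin]; push_cast; rfl
  set η : ℝ := (∑ k, x k) / (M0 * n) with hη
  have hηs : ∑ k, x k = η * (M0 * n) := by rw [hη]; field_simp
  refine ⟨η, ⟨?_, ?_⟩, ?_, ?_⟩
  · exact div_nonneg (sum_nonneg fun k _ => hx0 k) (by positivity)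
  · rw [hη, div_le_one (by positivity), ← hcard]
    calc ∑ k, x k ≤ ∑ k : Fin M0 × Fin n, (1 : ℝ) := sum_le_sum fun k _ => hx1 k
      _ = _ := by simp
  · set T : Finset (Σ _ : Fin M0, (Fin n → Fin 2) × (Fin n → Fin 2)) :=
      univ.sigma (fun i => C1 i ×ˢ C2 i) with hT
    have cT : (#T : ℝ) = M0 * (M1 * M2) := by
      rw [hT, card_sigma]; simp [hc1, hc2]
    have hTne : T.Nonempty := by
      rw [← card_pos]
      have : (0 : ℝ) < #T := by rw [cT]; positivity
      exact_mod_cast this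
    have hinj : Set.InjOn (fun t : (Σ _ : Fin M0, (Fin n → Fin 2) × (Fin n → Fin 2)) => auxG t.2) T := by
      rintro ⟨i, a, b⟩ ht ⟨i', a', b'⟩ ht' he
      have m : a ∈ C1 i ∧ b ∈ C2 i := by simpa [hT] using ht
      have m' : a' ∈ C1 i' ∧ b' ∈ C2 i' := by simpa [hT] using ht'
      have := hz (x₁ := (i, a, b)) (x₂ := (i', a', b')) m m' he
      simp only [Prod.mk.injEq] at this
      obtain ⟨rfl, rfl, rfl⟩ := this
      rfl
    have hmem : ∀ t ∈ T, ∀ j, (fun t : (Σ _ : Fin M0, (Fin n → Fin 2) × (Fin n → Fin 2)) => auxG t.2) t j ∈ range 3 :=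
      fun t _ j => auxG_mem t.2 j
    have hs := aux_subadd T hTne (fun t => auxG t.2) hmem hinj
    rw [cT] at hs
    have hP : ∀ j, auxP T (fun t => auxG t.2) j 1 = (∑ i, x (i, j)) / M0 := by
      intro j
      have : (#{t ∈ T | auxG t.2 j = 1} : ℝ) = ∑ i, x (i, j) * (M1 * M2) := by
        rw [card_filter, hT, sum_sigma]
        push_cast
        apply sum_congr rfl
        intro i _
        simp only [hx, auxP, card_product, hc1, hc2]
        rw [card_filter]
        push_cast
        field_simp
      unfold auxP
      rw [this, cT, ← sum_mul]
      field_simp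
    have hb : ∀ j, ∑ a ∈ range 3, Real.negMulLog (auxP T (fun t => auxG t.2) j a) ≤
        Real.binEntropy ((∑ i, x (i, j)) / M0) + (1 - (∑ i, x (i, j)) / M0) * Real.log 2 := by
      intro j
      rw [← hP]
      exact aux_C1 _ (fun a _ => auxP_nonneg _ _ _ _) (auxP_sum T hTne _ hmem j)
    have hj := aux_h_jensen (univ : Finset (Fin n)) univ_nonempty (fun j => (∑ i, x (i, j)) / M0)
      (fun j _ => by
        rw [← hP]; exact ⟨auxP_nonneg _ _ _ _, auxP_le_one _ _ _ _⟩)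
    have e : ∑ j, (∑ i, x (i, j)) / (M0 : ℝ) = η * n := by
      rw [← sum_div, ← Fintype.sum_prod_type_right, hηs]; field_simp
    rw [e, card_univ, Fintype.card_fin, mul_div_assoc, div_self hnR.ne', mul_one] at hj
    have hf := hs.trans (sum_le_sum fun j _ => hb j)
    rw [sum_add_distrib, ← sum_mul, sum_sub_distrib, e] at hf
    simp only [sum_const, card_univ, Fintype.card_fin, nsmul_eq_mul, mul_one] at hf
    linarith
  · have hi : ∀ i, Real.log (M1 * M2) ≤ ∑ j, (2 * Real.binEntropy (auxR (x (i, j))) - x (i, j) * Real.log 2) := by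
      intro i
      have hinj : Set.InjOn (auxG (n := n)) (C1 i ×ˢ C2 i : Finset _) := by
        rintro ⟨a, b⟩ ht ⟨a', b'⟩ ht' he
        have m : a ∈ C1 i ∧ b ∈ C2 i := by simpa using ht
        have m' : a' ∈ C1 i ∧ b' ∈ C2 i := by simpa using ht'
        have := hz (x₁ := (i, a, b)) (x₂ := (i, a', b')) m m' he
        simp only [Prod.mk.injEq] at this
        obtain ⟨-, rfl, rfl⟩ := this
        rfl
      have hs := aux_subadd (C1 i ×ˢ C2 i) ((ne1 i).product (ne2 i)) auxG (fun t _ j => auxG_mem t j) hinj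
      rw [card_product, hc1, hc2] at hs
      push_cast at hs
      exact hs.trans (sum_le_sum fun j _ => aux_pair _ _ (ne1 i) (ne2 i) j)
    have hsum := sum_le_sum (s := univ) fun i _ => hi i
    rw [← Fintype.sum_prod_type (f := fun k : Fin M0 × Fin n => 2 * Real.binEntropy (auxR (x k)) - x k * Real.log 2),
      sum_sub_distrib, ← mul_sum, ← sum_mul, hηs] at hsum
    simp only [sum_const, card_univ, Fintype.card_fin, nsmul_eq_mul] at hsum
    have hj := aux_K_jensen (univ : Finset (Fin M0 × Fin n)) univ_nonempty x (fun k _ => hx0 k)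
    rw [hcard, ← hη] at hj
    have : (M0 : ℝ) * Real.log (M1 * M2) ≤ M0 * (n * (2 * Real.binEntropy (auxR η) - η * Real.log 2)) := by
      linarith
    exact le_of_mul_le_mul_left this h0R

theorem aux_binH (p : ℝ) : binH p * Real.log 2 = Real.binEntropy p := by
  have : Real.log 2 ≠ 0 := by positivity
  rw [Real.binEntropy_eq_negMulLog_add_negMulLog_one_sub]
  unfold binH Real.logb Real.negMulLog
  field_simp
  ring

theorem aux_binH_le (p : ℝ) : binH p ≤ 1 := by
  have h : 0 < Real.log 2 := by positivity
  have := Real.binEntropy_le_log_two (p := p)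
  rw [← aux_binH] at this
  by_contra hc
  push Not at hc
  nlinarith

theorem aux_binH_half : binH (1 / 2) = 1 := by
  have hl : 0 < Real.log 2 := by positivity
  have := aux_binH (1 / 2)
  rw [one_div, Real.binEntropy_two_inv] at this
  rw [one_div]
  exact mul_right_cancel₀ hl.ne' (this.trans (one_mul _).symm)

end

theorem common_message_sum_rate_bound' (r0 r1 r2 : ℝ) (h : AdmissibleTriplet r0 r1 r2) :
    r0 + r1 + r2 ≤
      sSup ((fun η => min (binH η + 1 - η)
          (2 * binH (1 / 2 * (1 - Real.sqrt (1 - 2 * η))) - η + r0)) ''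
        Set.Icc (0 : ℝ) (1 / 2)) := by
  obtain ⟨hr0, hr1, hr2, h⟩ := h
  have hl2 : 0 < Real.log 2 := by positivity
  have hbdd : BddAbove ((fun η => min (binH η + 1 - η)
          (2 * binH (1 / 2 * (1 - Real.sqrt (1 - 2 * η))) - η + r0)) ''
        Set.Icc (0 : ℝ) (1 / 2)) := by
    refine ⟨2, ?_⟩
    rintro _ ⟨η, hη, rfl⟩
    refine (min_le_left _ _).trans ?_
    linarith [aux_binH_le η, hη.1]
  refine le_of_forall_pos_le_add fun δ hδ => ?_
  obtain ⟨n, hn, M0, M1, M2, C1, C2, hc1, hc2, hz, b0, b1, b2⟩ := h (δ / 3) (by positivity) 1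
  have p0 : (0 : ℝ) < M0 := lt_of_lt_of_le (by positivity) b0
  have p1 : (0 : ℝ) < M1 := lt_of_lt_of_le (by positivity) b1
  have p2 : (0 : ℝ) < M2 := lt_of_lt_of_le (by positivity) b2
  have hnR : (0 : ℝ) < n := by exact_mod_cast hn
  obtain ⟨η, hη, u1, u2⟩ := aux_main hn (by exact_mod_cast p0) (by exact_mod_cast p1)
    (by exact_mod_cast p2) C1 C2 hc1 hc2 hz
  have l0 := Real.log_le_log (by positivity) b0
  have l1 := Real.log_le_log (by positivity) b1
  have l2 := Real.log_le_log (by positivity) b2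
  rw [Real.log_rpow two_pos] at l0 l1 l2
  rw [Real.log_mul p0.ne' (by positivity), Real.log_mul p1.ne' p2.ne', ← aux_binH] at u1
  rw [Real.log_mul p1.ne' p2.ne', ← aux_binH] at u2
  have hk : 0 < (n : ℝ) * Real.log 2 := by positivity
  have v1 : r0 + r1 + r2 - δ ≤ binH η + 1 - η := by
    refine le_of_mul_le_mul_left ?_ hk
    linarith
  have v2 : r1 + r2 - δ ≤ 2 * binH (auxR η) - η := by
    refine le_of_mul_le_mul_left ?_ hk
    have : 0 < n * Real.log 2 * δ := by positivity
    linarith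
  suffices r0 + r1 + r2 - δ ≤ sSup ((fun η => min (binH η + 1 - η)
          (2 * binH (1 / 2 * (1 - Real.sqrt (1 - 2 * η))) - η + r0)) ''
        Set.Icc (0 : ℝ) (1 / 2)) by linarith
  rcases le_total η (1 / 2) with hh | hh
  · refine le_trans ?_ (le_csSup hbdd ⟨η, ⟨hη.1, hh⟩, rfl⟩)
    refine le_min v1 ?_
    unfold auxR at v2
    linarith
  · refine le_trans ?_ (le_csSup hbdd ⟨1 / 2, ⟨by norm_num, le_rfl⟩, rfl⟩)
    have e : (1 / 2 : ℝ) * (1 - Real.sqrt (1 - 2 * (1 / 2))) = 1 / 2 := by norm_num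
    refine le_min ?_ ?_
    · rw [aux_binH_half]; linarith [aux_binH_le η]
    · rw [e, aux_binH_half]; linarith [aux_binH_le η]
end

section
/- For every finite family 𝓕 of subsets of [n] and every integer k ≥ 1, there exists a monotone family 𝒢 of subsets of [n] with |𝒢| = |𝓕| such that every S ⊆ [n] that is k-shattered by 𝒢 is also k-shattered by 𝓕. -/
/-- A family of subsets of `[n]` is monotone (downward closed). -/
def MonotoneFamily {n : ℕ} (G : Finset (Finset (Fin n))) : Prop :=
  ∀ g ∈ G, ∀ h : Finset (Fin n), h ⊆ g → h ∈ G

/-- `S ⊆ [n]` is `k`-shattered by a family `G` of subsets of `[n]`: for every `T ⊆ S`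
there are at least `k` members `g ∈ G` with `g ∩ S = T`. -/
def FamKShatters {n : ℕ} (k : ℕ) (G : Finset (Finset (Fin n))) (S : Finset (Fin n)) : Prop :=
  ∀ T : Finset (Fin n), T ⊆ S → k ≤ (G.filter (fun g => g ∩ S = T)).card

open Finset in
theorem kshatters_of_compression {n : ℕ} (k : ℕ) (a : Fin n) (F : Finset (Finset (Fin n)))
    (S : Finset (Fin n)) (h : FamKShatters k (Down.compression a F) S) : FamKShatters k F S := by
  intro T hT
  by_cases ha : a ∈ S
  · have h1 := h (insert a T) (insert_subset ha hT)
    have key : ∀ g ∈ (Down.compression a F).filter (fun g => g ∩ S = insert a T),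
        g ∈ F ∧ g.erase a ∈ F ∧ a ∈ g ∧ g ∩ S = insert a T := by
      intro g hg
      rw [mem_filter, Down.mem_compression] at hg
      obtain ⟨hg, hgS⟩ := hg
      have hag : a ∈ g := by
        have : a ∈ g ∩ S := by rw [hgS]; exact mem_insert_self _ _
        exact (mem_inter.1 this).1
      rcases hg with hg | hg
      · exact ⟨hg.1, hg.2, hag, hgS⟩
      · rw [insert_eq_of_mem hag] at hg
        exact absurd hg.2 hg.1
    refine h1.trans ?_
    by_cases haT : a ∈ T
    · refine card_le_card fun g hg => ?_
      obtain ⟨k1, -, -, k4⟩ := key g hg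
      rw [insert_eq_of_mem haT] at k4
      exact mem_filter.2 ⟨k1, k4⟩
    · refine card_le_card_of_injOn (fun g => g.erase a) ?_ ?_
      · intro g hg
        obtain ⟨-, k2, -, k4⟩ := key g hg
        refine mem_coe.2 (mem_filter.2 ⟨k2, ?_⟩)
        rw [erase_inter, k4, erase_insert haT]
      · intro g hg g' hg' e
        have k3 := (key g hg).2.2.1
        have k3' := (key g' hg').2.2.1
        have e' : g.erase a = g'.erase a := e
        rw [← insert_erase k3, e', insert_erase k3']
  · refine (h T hT).trans (le_of_eq ?_)
    rw [← Down.card_compression a (F.filter (fun g => g ∩ S = T))]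
    congr 1
    ext g
    have e1 : g.erase a ∩ S = g ∩ S := by
      ext x; simp only [mem_inter, mem_erase]
      constructor
      · tauto
      · rintro ⟨h1, h2⟩
        exact ⟨⟨fun h => ha (h ▸ h2), h1⟩, h2⟩
    have e2 : insert a g ∩ S = g ∩ S := insert_inter_of_notMem ha
    simp only [mem_filter, Down.mem_compression, e1, e2]
    tauto

open Finset in
theorem compression_closed {n : ℕ} (a b : Fin n) (F : Finset (Finset (Fin n)))
    (h : ∀ s ∈ F, s.erase a ∈ F) : ∀ s ∈ Down.compression b F, s.erase a ∈ Down.compression b F := by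
  intro s hs
  by_cases hab : a = b
  · subst hab; exact Down.erase_mem_compression_of_mem_compression hs
  rw [Down.mem_compression] at hs ⊢
  rcases hs with ⟨h1, h2⟩ | ⟨h1, h2⟩
  · left
    refine ⟨h _ h1, ?_⟩
    rw [erase_right_comm]; exact h _ h2
  · have hb : b ∉ s := fun hb => h1 (by rwa [insert_eq_of_mem hb] at h2)
    have h3 := h _ h2
    rw [erase_insert_of_ne (Ne.symm hab)] at h3
    by_cases h4 : s.erase a ∈ F
    · left
      refine ⟨h4, ?_⟩
      rwa [erase_eq_of_notMem (fun hh => hb (mem_of_mem_erase hh))]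
    · exact Or.inr ⟨h4, h3⟩

theorem exists_closed {n : ℕ} (F : Finset (Finset (Fin n))) (k : ℕ) (A : Finset (Fin n)) :
    ∃ G : Finset (Finset (Fin n)), (∀ a ∈ A, ∀ s ∈ G, s.erase a ∈ G) ∧ G.card = F.card ∧
      ∀ S : Finset (Fin n), FamKShatters k G S → FamKShatters k F S := by
  induction A using Finset.induction_on with
  | empty => exact ⟨F, by simp, rfl, fun _ h => h⟩
  | insert b A _ ih =>
    obtain ⟨G, h1, h2, h3⟩ := ih
    refine ⟨Down.compression b G, ?_, by rw [Down.card_compression, h2],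
      fun S hS => h3 S (kshatters_of_compression k b G S hS)⟩
    intro a ha
    rcases Finset.mem_insert.1 ha with rfl | ha
    · exact fun s hs => Down.erase_mem_compression_of_mem_compression hs
    · exact compression_closed a b G (h1 a ha)

/-- Every family can be shifted to a monotone family of the same cardinality whose
`k`-shattered sets are also `k`-shattered by the original family. -/
theorem shifting_to_monotone {n : ℕ} (F : Finset (Finset (Fin n))) (k : ℕ) (hk : 1 ≤ k) :
    ∃ G : Finset (Finset (Fin n)), MonotoneFamily G ∧ G.card = F.card ∧
      ∀ S : Finset (Fin n), FamKShatters k G S → FamKShatters k F S := by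
  obtain ⟨G, h1, h2, h3⟩ := exists_closed F k Finset.univ
  refine ⟨G, ?_, h2, h3⟩
  have key : ∀ (D g : Finset (Fin n)), g ∈ G → g \ D ∈ G := by
    intro D
    induction D using Finset.induction_on with
    | empty => intro g hg; simpa using hg
    | insert a D _ ih =>
      intro g hg
      rw [Finset.sdiff_insert]
      exact h1 a (Finset.mem_univ a) _ (ih g hg)
  intro g hg h hh
  have := key (g \ h) g hg
  rwa [Finset.sdiff_sdiff_eq_self hh] at this
end

section
/- Let 𝒢' be a finite family of subsets of [n], let i ∈ [n], define 𝒢̃ᵢ = {G ∈ 𝒢' : i ∈ G and G∖{i} ∉ 𝒢'}, and let 𝒢 = (𝒢' ∖ 𝒢̃ᵢ) ∪ {G∖{i} : G ∈ 𝒢̃ᵢ}. Then |𝒢| = |𝒢'|, and for every integer k ≥ 1, every S ⊆ [n] that is k-shattered by 𝒢 is also k-shattered by 𝒢'. -/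
theorem mem_shifted_iff {n : ℕ} (G' : Finset (Finset (Fin n))) (i : Fin n) (h : Finset (Fin n)) :
    h ∈ ((G' \ G'.filter (fun g => i ∈ g ∧ g.erase i ∉ G')) ∪
        (G'.filter (fun g => i ∈ g ∧ g.erase i ∉ G')).image (fun g => g.erase i)) ↔
      (h ∈ G' ∧ (i ∈ h → h.erase i ∈ G')) ∨ (i ∉ h ∧ h ∉ G' ∧ insert i h ∈ G') := by
  simp only [Finset.mem_union, Finset.mem_sdiff, Finset.mem_filter, Finset.mem_image]
  constructor
  · rintro (⟨h1, h2⟩ | ⟨g, ⟨h1, h2, h3⟩, rfl⟩)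
    · left
      refine ⟨h1, fun hi => ?_⟩
      by_contra hc
      exact h2 ⟨h1, hi, hc⟩
    · right
      refine ⟨Finset.notMem_erase i g, h3, ?_⟩
      rwa [Finset.insert_erase h2]
  · rintro (⟨h1, h2⟩ | ⟨h1, h2, h3⟩)
    · left
      exact ⟨h1, fun hc => hc.2.2 (h2 hc.2.1)⟩
    · right
      refine ⟨insert i h, ⟨h3, Finset.mem_insert_self i h, ?_⟩, Finset.erase_insert h1⟩
      rwa [Finset.erase_insert h1]

/-- The shifting step: replacing each `G ∈ 𝒢'` containing `i` with `G ∖ {i} ∉ 𝒢'` by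
`G ∖ {i}` preserves the cardinality of the family, and any `S` that is `k`-shattered by
the shifted family is `k`-shattered by the original family. -/
theorem shifting_step {n : ℕ} (G' : Finset (Finset (Fin n))) (i : Fin n) :
    ((G' \ G'.filter (fun g => i ∈ g ∧ g.erase i ∉ G')) ∪
        (G'.filter (fun g => i ∈ g ∧ g.erase i ∉ G')).image (fun g => g.erase i)).card
      = G'.card ∧
    ∀ k : ℕ, 1 ≤ k → ∀ S : Finset (Fin n),
      FamKShatters k
        ((G' \ G'.filter (fun g => i ∈ g ∧ g.erase i ∉ G')) ∪
          (G'.filter (fun g => i ∈ g ∧ g.erase i ∉ G')).image (fun g => g.erase i)) S →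
      FamKShatters k G' S := by
  constructor
  · rw [Finset.card_union_of_disjoint, Finset.card_image_of_injOn]
    · exact Finset.card_sdiff_add_card_eq_card (Finset.filter_subset _ _)
    · intro a ha b hb hab
      simp only [Finset.coe_filter, Set.mem_ofPred_eq] at ha hb hab
      rw [← Finset.insert_erase ha.2.1, ← Finset.insert_erase hb.2.1, hab]
    · rw [Finset.disjoint_left]
      intro a ha hb
      obtain ⟨g, hg, rfl⟩ := Finset.mem_image.1 hb
      exact (Finset.mem_filter.1 hg).2.2 (Finset.mem_sdiff.1 ha).1
  · intro k _ S hS T hT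
    by_cases hiS : i ∈ S
    · -- the members tracing `insert i T` come in pairs
      refine (hS (insert i T) (Finset.insert_subset hiS hT)).trans ?_
      have key : ∀ g, g ∈ ((G' \ G'.filter (fun g => i ∈ g ∧ g.erase i ∉ G')) ∪
          (G'.filter (fun g => i ∈ g ∧ g.erase i ∉ G')).image (fun g => g.erase i)) →
          g ∩ S = insert i T → i ∈ g ∧ g ∈ G' ∧ g.erase i ∈ G' := by
        intro g hg hgS
        have hig : i ∈ g :=
          (Finset.mem_inter.1 (hgS ▸ Finset.mem_insert_self i T : i ∈ g ∩ S)).1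
        rcases (mem_shifted_iff G' i g).1 hg with h | h
        · exact ⟨hig, h.1, h.2 hig⟩
        · exact absurd hig h.1
      by_cases hiT : i ∈ T
      · apply Finset.card_le_card
        intro g hg
        obtain ⟨h1, h2⟩ := Finset.mem_filter.1 hg
        refine Finset.mem_filter.2 ⟨(key g h1 h2).2.1, ?_⟩
        rw [h2, Finset.insert_eq_of_mem hiT]
      · apply Finset.card_le_card_of_injOn (fun g => g.erase i)
        · intro g hg
          obtain ⟨h1, h2⟩ := Finset.mem_filter.1 (Finset.mem_coe.1 hg)
          refine Finset.mem_coe.2 (Finset.mem_filter.2 ⟨(key g h1 h2).2.2, ?_⟩)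
          rw [Finset.erase_inter, h2, Finset.erase_insert hiT]
        · intro a ha b hb hab
          obtain ⟨a1, a2⟩ := Finset.mem_filter.1 (Finset.mem_coe.1 ha)
          obtain ⟨b1, b2⟩ := Finset.mem_filter.1 (Finset.mem_coe.1 hb)
          simp only at hab
          rw [← Finset.insert_erase (key a a1 a2).1, ← Finset.insert_erase (key b b1 b2).1, hab]
    · refine (hS T hT).trans ?_
      apply Finset.card_le_card_of_injOn (fun g => if g ∈ G' then g else insert i g)
      · intro g hg
        obtain ⟨h1, h2⟩ := Finset.mem_filter.1 (Finset.mem_coe.1 hg)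
        refine Finset.mem_coe.2 (Finset.mem_filter.2 ?_)
        by_cases hgG : g ∈ G'
        · simpa only [if_pos hgG] using ⟨hgG, h2⟩
        · simp only [if_neg hgG]
          rcases (mem_shifted_iff G' i g).1 h1 with h | h
          · exact absurd h.1 hgG
          · exact ⟨h.2.2, by rw [Finset.insert_inter_of_notMem hiS, h2]⟩
      · intro a ha b hb hab
        have a1 := (mem_shifted_iff G' i a).1 (Finset.mem_filter.1 (Finset.mem_coe.1 ha)).1
        have b1 := (mem_shifted_iff G' i b).1 (Finset.mem_filter.1 (Finset.mem_coe.1 hb)).1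
        have cross : ∀ c d : Finset (Fin n), (c ∈ G' ∧ (i ∈ c → c.erase i ∈ G')) →
            i ∉ d → d ∉ G' → c = insert i d → False := by
          rintro c d ⟨_, hc⟩ hid hd rfl
          have := hc (Finset.mem_insert_self i d)
          rw [Finset.erase_insert hid] at this
          exact hd this
        simp only at hab
        rcases a1 with a1 | ⟨a1, a2, a3⟩ <;> rcases b1 with b1 | ⟨b1, b2, b3⟩
        · rwa [if_pos a1.1, if_pos b1.1] at hab
        · rw [if_pos a1.1, if_neg b2] at hab
          exact (cross a b a1 b1 b2 hab).elim
        · rw [if_neg a2, if_pos b1.1] at hab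
          exact (cross b a b1 a1 a2 hab.symm).elim
        · rw [if_neg a2, if_neg b2] at hab
          rw [← Finset.erase_insert a1, hab, Finset.erase_insert b1]
end

section
/- Let d ≤ t ≤ n and let 𝒢ₜ be a family of subsets of [n] each of cardinality t. Then there exists a subset S ⊆ [n] of cardinality d that is contained in at least |𝒢ₜ|·C(t,d)/C(n,d) members of 𝒢ₜ. (Here C(a,b) denotes the binomial coefficient.) -/
/-- Counting argument: among a family `Gt` of `t`-element subsets of `[n]`, some
`d`-element set `S ⊆ [n]` is contained in at least `|Gt|·C(t,d)/C(n,d)` members. -/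
theorem popular_subset {n d t : ℕ} (hdt : d ≤ t) (htn : t ≤ n)
    (Gt : Finset (Finset (Fin n))) (hcard : ∀ g ∈ Gt, g.card = t) :
    ∃ S : Finset (Fin n), S.card = d ∧
      (Gt.card : ℝ) * (t.choose d : ℝ) / (n.choose d : ℝ)
        ≤ ((Gt.filter (fun g => S ⊆ g)).card : ℝ) := by
  have hpos : 0 < n.choose d := Nat.choose_pos (hdt.trans htn)
  have hposR : (0 : ℝ) < (n.choose d : ℝ) := by exact_mod_cast hpos
  have hPcard : (Finset.powersetCard d (Finset.univ : Finset (Fin n))).card = n.choose d := by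
    simp
  have hne : (Finset.powersetCard d (Finset.univ : Finset (Fin n))).Nonempty := by
    rw [← Finset.card_pos, hPcard]; exact hpos
  have hdc : ∑ S ∈ Finset.powersetCard d (Finset.univ : Finset (Fin n)),
      (Gt.filter (fun g => S ⊆ g)).card = Gt.card * t.choose d := by
    have h := Finset.sum_card_bipartiteAbove_eq_sum_card_bipartiteBelow
      (s := Finset.powersetCard d (Finset.univ : Finset (Fin n))) (t := Gt)
      (fun S g => S ⊆ g)
    unfold Finset.bipartiteAbove Finset.bipartiteBelow at h
    rw [h, ← smul_eq_mul, ← Finset.sum_const]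
    refine Finset.sum_congr rfl fun g hg => ?_
    rw [← hcard g hg, ← Finset.card_powersetCard]
    congr 1
    ext S
    simp [Finset.mem_powersetCard, and_comm]
  obtain ⟨S, hS, hle⟩ := Finset.exists_le_of_sum_le hne
    (f := fun _ => (Gt.card : ℝ) * (t.choose d : ℝ) / (n.choose d : ℝ))
    (g := fun S : Finset (Fin n) => ((Gt.filter (fun g => S ⊆ g)).card : ℝ)) (by
      rw [Finset.sum_const, hPcard, nsmul_eq_mul, mul_div_cancel₀ _ hposR.ne']
      exact_mod_cast hdc.ge)
  exact ⟨S, (Finset.mem_powersetCard.mp hS).2, hle⟩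
end

section
/- Let C1, C2 ⊆ {0,1}^n form a zero-error codebook pair and let S ⊆ [n]. For g ∈ {0,1}^S and j ∈ {1,2}, let C_{j,g} = {c ∈ C_j : c(S) = g}, and let ḡ denote the coordinatewise binary complement of g. Then the map sending a triple (g, c1, c2) with g ∈ {0,1}^S, c1 ∈ C_{1,ḡ}, c2 ∈ C_{2,g} to the restriction of c1+c2 to the complement of S is injective; in particular, for each g the pair of restricted codebooks (C_{1,ḡ} restricted to the complement of S, C_{2,g} restricted to the complement of S) is a zero-error codebook pair (counting multiplicities), and their sumsets over distinct g are disjoint, i.e., they form a zero-error system over the complement of S. -/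
/-- `C1, C2 ⊆ {0,1}^n` form a zero-error codebook pair: the sum map is injective on `C1 × C2`. -/
def ZeroErrorPair {n : ℕ} (C1 C2 : Finset (Fin n → Fin 2)) : Prop :=
  Set.InjOn
    (fun p : (Fin n → Fin 2) × (Fin n → Fin 2) => fun i : Fin n => (p.1 i : ℕ) + (p.2 i : ℕ))
    (↑(C1 ×ˢ C2))

/-- Partitioning a zero-error codebook pair according to the projections on `S`:
the map `(g, c1, c2) ↦ (c1 + c2)` restricted to the complement of `S`, where
`c1 ∈ C1` has `c1(S) = ḡ` (the binary complement of `g`) and `c2 ∈ C2` has `c2(S) = g`,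
is injective; in particular, for each `g` the restricted pair is zero-error (counting
multiplicities), and the restricted sumsets over distinct `g` are disjoint, i.e. the
restricted pairs form a zero-error system over the complement of `S`. -/
theorem partition_zero_error_system {n : ℕ} (C1 C2 : Finset (Fin n → Fin 2))
    (S : Finset (Fin n)) (hze : ZeroErrorPair C1 C2) :
    Set.InjOn
      (fun p : (↥S → Fin 2) × (Fin n → Fin 2) × (Fin n → Fin 2) =>
        fun i : ↥(Sᶜ) => (p.2.1 i.1 : ℕ) + (p.2.2 i.1 : ℕ))
      {p : (↥S → Fin 2) × (Fin n → Fin 2) × (Fin n → Fin 2) |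
        p.2.1 ∈ C1 ∧ (∀ i : ↥S, p.2.1 i.1 = 1 - p.1 i) ∧
        p.2.2 ∈ C2 ∧ (∀ i : ↥S, p.2.2 i.1 = p.1 i)} ∧
    (∀ g : ↥S → Fin 2,
      Set.InjOn
        (fun q : (Fin n → Fin 2) × (Fin n → Fin 2) =>
          fun i : ↥(Sᶜ) => (q.1 i.1 : ℕ) + (q.2 i.1 : ℕ))
        {q : (Fin n → Fin 2) × (Fin n → Fin 2) |
          q.1 ∈ C1 ∧ (∀ i : ↥S, q.1 i.1 = 1 - g i) ∧
          q.2 ∈ C2 ∧ (∀ i : ↥S, q.2 i.1 = g i)}) ∧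
    (∀ g g' : ↥S → Fin 2, g ≠ g' →
      ∀ q q' : (Fin n → Fin 2) × (Fin n → Fin 2),
        (q.1 ∈ C1 ∧ (∀ i : ↥S, q.1 i.1 = 1 - g i) ∧
          q.2 ∈ C2 ∧ (∀ i : ↥S, q.2 i.1 = g i)) →
        (q'.1 ∈ C1 ∧ (∀ i : ↥S, q'.1 i.1 = 1 - g' i) ∧
          q'.2 ∈ C2 ∧ (∀ i : ↥S, q'.2 i.1 = g' i)) →
        (fun i : ↥(Sᶜ) => (q.1 i.1 : ℕ) + (q.2 i.1 : ℕ)) ≠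
          (fun i : ↥(Sᶜ) => (q'.1 i.1 : ℕ) + (q'.2 i.1 : ℕ))) := by
  have hone : ∀ x : Fin 2, ((1 - x : Fin 2) : ℕ) + (x : ℕ) = 1 := by decide
  have key : ∀ g g' : ↥S → Fin 2, ∀ q q' : (Fin n → Fin 2) × (Fin n → Fin 2),
      (q.1 ∈ C1 ∧ (∀ i : ↥S, q.1 i.1 = 1 - g i) ∧
        q.2 ∈ C2 ∧ (∀ i : ↥S, q.2 i.1 = g i)) →
      (q'.1 ∈ C1 ∧ (∀ i : ↥S, q'.1 i.1 = 1 - g' i) ∧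
        q'.2 ∈ C2 ∧ (∀ i : ↥S, q'.2 i.1 = g' i)) →
      (fun i : ↥(Sᶜ) => (q.1 i.1 : ℕ) + (q.2 i.1 : ℕ)) =
        (fun i : ↥(Sᶜ) => (q'.1 i.1 : ℕ) + (q'.2 i.1 : ℕ)) → g = g' ∧ q = q' := by
    rintro g g' q q' ⟨h1, h2, h3, h4⟩ ⟨k1, k2, k3, k4⟩ h
    have hq : q = q' := by
      apply hze
      · simp [h1, h3]
      · simp [k1, k3]
      · funext i
        by_cases hi : i ∈ S
        · have e1 := h2 ⟨i, hi⟩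
          have e2 := h4 ⟨i, hi⟩
          have e3 := k2 ⟨i, hi⟩
          have e4 := k4 ⟨i, hi⟩
          dsimp only at e1 e2 e3 e4 ⊢
          rw [e1, e2, e3, e4, hone, hone]
        · exact congrFun h ⟨i, Finset.mem_compl.mpr hi⟩
    refine ⟨?_, hq⟩
    funext i
    rw [← h4 i, ← k4 i, hq]
  refine ⟨?_, ?_, ?_⟩
  · rintro ⟨g, q⟩ hp ⟨g', q'⟩ hp' h
    obtain ⟨hg, hq⟩ := key g g' q q' hp hp' h
    rw [hg, hq]
  · intro g q hq q' hq' h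
    exact (key g g q q' hq hq' h).2
  · intro g g' hne q q' hq hq' h
    exact hne (key g g' q q' hq hq' h).1
end
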